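/- arXiv:2403.10712 — 3 statements merged into one kernel-verified Lean document; each statement's English description precedes it below -/
import Mathlib

section
/- Fix integers ℓ ≥ 1 and n ≥ 3ℓ−1. For every primitive embedding φ : A₂^{⊕ℓ} → A_n there is an element w of the Weyl group W(A_n) such that w maps the image φ(A₂^{⊕ℓ}) onto the submodule N of A_n generated by the elements a_{3i+1}, a_{3i+2} for 0 ≤ i ≤ ℓ−1; i.e., the primitive embedding of A₂^{⊕ℓ} into A_n is unique up to the action of W(A_n). -/
namespace Paper

/-- A `ℤ`-valued bilinear form on a `ℤ`-module (the pairing of a lattice). -/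
abbrev Form (L : Type*) [AddCommGroup L] [Module ℤ L] : Type _ := L →ₗ[ℤ] L →ₗ[ℤ] ℤ

variable {L : Type*} [AddCommGroup L] [Module ℤ L]

/-- `N^{⊥L}`: the orthogonal complement of a submodule `N` with respect to a bilinear
form `B`, i.e. `{x ∈ L | ⟨x,n⟩ = 0 for all n ∈ N}`. -/
def orth (B : Form L) (N : Submodule ℤ L) : Submodule ℤ L where
  carrier := {x | ∀ n ∈ N, B x n = 0}
  add_mem' := by
    intro a b ha hb n hn
    simp [ha n hn, hb n hn]
  zero_mem' := by intro n hn; simp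
  smul_mem' := by
    intro c a ha n hn
    simp [ha n hn]
/-- The Weyl group of a lattice: the subgroup of the linear automorphism group generated
by the reflections `x ↦ x + ⟨x,r⟩·r` in the roots `r` (elements with `⟨r,r⟩ = -2`);
each such reflection preserves the bilinear form. -/
def weylGroup (B : Form L) : Subgroup (L ≃ₗ[ℤ] L) :=
  Subgroup.closure {e | ∃ r : L, B r r = -2 ∧ ∀ x, e x = x + B x r • r}
/-- The bilinear form on `ι → ℤ` associated to a Gram matrix `M`:
`⟨x,y⟩ = ∑ i, ∑ j, x i * M i j * y j`. -/
def gram {ι : Type*} [Fintype ι] [DecidableEq ι] (M : Matrix ι ι ℤ) : Form (ι → ℤ) :=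
  Matrix.toLinearMap₂' ℤ M
/-- The Gram matrix of the negative definite root lattice `A_n`: `⟨aᵢ,aᵢ⟩ = -2`,
`⟨aᵢ,aⱼ⟩ = 1` if `|i-j| = 1` and `0` otherwise (indices `0`-based). -/
def AMat (n : ℕ) : Matrix (Fin n) (Fin n) ℤ := fun i j =>
  if i = j then -2 else if (i : ℕ) + 1 = (j : ℕ) ∨ (j : ℕ) + 1 = (i : ℕ) then 1 else 0
/-- The Gram matrix of the orthogonal direct sum `A₂^{⊕ℓ}`, on the index type
`Fin ℓ × Fin 2`. -/
def A2PowMat (ℓ : ℕ) : Matrix (Fin ℓ × Fin 2) (Fin ℓ × Fin 2) ℤ := fun p q =>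
  if p.1 = q.1 then AMat 2 p.2 q.2 else 0
/-- The generators `a_{3i+1}, a_{3i+2}` (`1`-based), for `0 ≤ i ≤ ℓ-1`, of the standard
copy of `A₂^{⊕ℓ}` inside `A_n`; `stdGen ℓ n ⟨i,s⟩` is the basis vector with a `1` in
(`0`-based) position `3i+s`. -/
def stdGen (ℓ n : ℕ) : Fin ℓ × Fin 2 → Fin n → ℤ := fun p j =>
  if (j : ℕ) = 3 * (p.1 : ℕ) + (p.2 : ℕ) then 1 else 0

theorem gram_single_single {ι : Type*} [Fintype ι] [DecidableEq ι] (M : Matrix ι ι ℤ) (i j : ι) :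
    gram M (Pi.single i 1) (Pi.single j 1) = M i j := by
  simp [gram, Matrix.toLinearMap₂'_apply']

/-- The embedding of `A_n` into `ℤ^{n+1}` sending `a_i` to `e_i - e_{i+1}`. -/
def toCoords (n : ℕ) : (Fin n → ℤ) →ₗ[ℤ] (Fin (n + 1) → ℤ) :=
  ∑ i : Fin n, (LinearMap.proj i).smulRight
    (Pi.single i.castSucc (1 : ℤ) - Pi.single i.succ (1 : ℤ) : Fin (n + 1) → ℤ)

theorem toCoords_apply {n : ℕ} (x : Fin n → ℤ) :
    toCoords n x = ∑ i : Fin n, x i •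
      (Pi.single i.castSucc (1 : ℤ) - Pi.single i.succ (1 : ℤ) : Fin (n + 1) → ℤ) := by
  simp [toCoords]

theorem toCoords_single {n : ℕ} (i : Fin n) :
    toCoords n (Pi.single i 1) = Pi.single i.castSucc 1 - Pi.single i.succ 1 := by
  rw [toCoords_apply, Finset.sum_eq_single i] <;> simp +contextual

theorem sum_toCoords {n : ℕ} (x : Fin n → ℤ) : ∑ k, toCoords n x k = 0 := by
  simp only [toCoords_apply, Finset.sum_apply]
  rw [Finset.sum_comm]
  simp [← Finset.mul_sum]

theorem gram_AMat_eq_neg_dotProduct {n : ℕ} (x y : Fin n → ℤ) :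
    gram (AMat n) x y = -(toCoords n x ⬝ᵥ toCoords n y) := by
  have h : gram (AMat n) =
      -((dotProductBilin ℤ ℤ : _ →ₗ[ℤ] _ →ₗ[ℤ] ℤ).compl₁₂ (toCoords n) (toCoords n)) := by
    refine LinearMap.ext_basis (Pi.basisFun ℤ (Fin n)) (Pi.basisFun ℤ (Fin n)) fun i j => ?_
    simp only [Pi.basisFun_apply, gram_single_single, LinearMap.neg_apply,
      LinearMap.compl₁₂_apply, toCoords_single, dotProductBilin_apply_apply, AMat]
    simp only [sub_dotProduct, single_dotProduct, Pi.sub_apply, Pi.single_apply, Fin.ext_iff,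
      Fin.val_castSucc, Fin.val_succ]
    split_ifs <;> omega
  rw [h]
  simp

theorem toCoords_injective (n : ℕ) : Function.Injective (toCoords n) := by
  rw [injective_iff_map_eq_zero]
  intro x hx
  have key : ∀ m (hm : m < n), x ⟨m, hm⟩ = 0 := by
    intro m
    induction m with
    | zero =>
      intro hm
      have h := congrFun hx (Fin.castSucc ⟨0, hm⟩)
      rw [toCoords_apply, Finset.sum_apply, Finset.sum_eq_single ⟨0, hm⟩] at h
      · simpa [Pi.single_apply, Fin.ext_iff] using h
      · intro b _ hb
        simp only [ne_eq, Fin.ext_iff] at hb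
        simp [Fin.ext_iff, Ne.symm hb]
      · simp
    | succ m ih =>
      intro hm
      have h := congrFun hx (Fin.castSucc ⟨m + 1, hm⟩)
      rw [toCoords_apply, Finset.sum_apply, Finset.sum_eq_single ⟨m + 1, hm⟩] at h
      · simpa [Pi.single_apply, Fin.ext_iff] using h
      · intro b _ hb
        simp only [ne_eq, Fin.ext_iff] at hb
        by_cases hbm : (b : ℕ) = m
        · have : b = ⟨m, by omega⟩ := Fin.ext hbm
          simp [this, ih]
        · simp [Fin.ext_iff, Ne.symm hb, Ne.symm hbm]
      · simp
  exact funext fun i => key i i.2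

theorem single_sub_single_mem_range {n : ℕ} (i j : Fin (n + 1)) :
    (Pi.single i 1 - Pi.single j 1 : Fin (n + 1) → ℤ) ∈ LinearMap.range (toCoords n) := by
  have key : ∀ i : Fin (n + 1),
      (Pi.single 0 1 - Pi.single i 1 : Fin (n + 1) → ℤ) ∈ LinearMap.range (toCoords n) := by
    intro i
    induction i using Fin.induction with
    | zero => simp
    | succ i ih =>
      have := add_mem ih ⟨_, toCoords_single i⟩
      simpa using this
  simpa using sub_mem (key j) (key i)

theorem exists_weylGroup_comp_perm {n : ℕ} (σ : Equiv.Perm (Fin (n + 1))) :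
    ∃ w ∈ weylGroup (gram (AMat n)), ∀ x, toCoords n (w x) = toCoords n x ∘ σ := by
  induction σ using Equiv.Perm.swap_induction_on with
  | one => exact ⟨1, one_mem _, fun x => rfl⟩
  | swap_mul σ i j hij ih =>
    obtain ⟨w, hw, hwx⟩ := ih
    obtain ⟨r, hr⟩ := single_sub_single_mem_range i j
    have hrr : gram (AMat n) r r = -2 := by
      simp [gram_AMat_eq_neg_dotProduct, hr, hij, hij.symm]
    have h2 : (-(gram (AMat n)).flip r) r = 2 := by simp [hrr]
    refine ⟨w * Module.reflection h2, mul_mem hw (Subgroup.subset_closure ⟨r, hrr, fun x => ?_⟩),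
      fun x => ?_⟩
    · simp [Module.reflection_apply]
    · rw [LinearEquiv.mul_apply, hwx, Equiv.Perm.coe_mul, ← Function.comp_assoc]
      congr 1
      ext k
      simp only [Module.reflection_apply, LinearMap.neg_apply, LinearMap.flip_apply,
        gram_AMat_eq_neg_dotProduct, map_sub, map_smul, hr, dotProduct_sub, dotProduct_single,
        Function.comp_apply, Equiv.swap_apply_def, Pi.sub_apply, Pi.smul_apply, smul_eq_mul,
        Pi.single_apply]
      split_ifs <;> simp_all

theorem exists_eq_single_sub_single {ι : Type*} [Fintype ι] [DecidableEq ι] (v : ι → ℤ)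
    (hsum : ∑ k, v k = 0) (hsq : v ⬝ᵥ v = 2) :
    ∃ i j, i ≠ j ∧ v = Pi.single i 1 - Pi.single j 1 := by
  have hv : ∃ k ∈ Finset.univ, v k ≠ 0 := by
    by_contra! h
    have : v = 0 := funext fun k => h k (Finset.mem_univ k)
    simp [this] at hsq
  obtain ⟨i, -, hi⟩ := Finset.exists_pos_of_sum_zero_of_exists_nonzero v hsum hv
  obtain ⟨j, -, hj⟩ := Finset.exists_pos_of_sum_zero_of_exists_nonzero (s := Finset.univ) (-v)
    (by simp [hsum]) (by simpa using hv)
  simp only [Pi.neg_apply, Left.neg_pos_iff] at hj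
  have hij : i ≠ j := by rintro rfl; omega
  have hle : ∀ s : Finset ι, ∑ k ∈ s, v k * v k ≤ 2 := fun s => hsq ▸
    Finset.sum_le_sum_of_subset_of_nonneg (Finset.subset_univ s) fun k _ _ => mul_self_nonneg _
  have h2 := hle {i, j}
  rw [Finset.sum_pair hij] at h2
  have hi1 : v i = 1 := by nlinarith
  have hj1 : v j = -1 := by nlinarith
  refine ⟨i, j, hij, funext fun k => ?_⟩
  by_cases hki : k = i
  · subst hki; simp [hi1, hij]
  by_cases hkj : k = j
  · subst hkj; simp [hj1, hij.symm]
  have h3 := hle {k, i, j}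
  rw [Finset.sum_insert (by simp [hki, hkj]), Finset.sum_pair hij, hi1, hj1] at h3
  have : v k * v k = 0 := le_antisymm (by linarith) (mul_self_nonneg _)
  simpa [hki, hkj] using this

theorem single_sub_single_dotProduct {ι : Type*} [Fintype ι] [DecidableEq ι] (a b c d : ι) :
    (Pi.single a 1 - Pi.single b 1 : ι → ℤ) ⬝ᵥ (Pi.single c 1 - Pi.single d 1) =
      (if a = c then 1 else 0) - (if a = d then 1 else 0) -
        ((if b = c then 1 else 0) - (if b = d then 1 else 0)) := by
  simp only [sub_dotProduct, single_one_dotProduct, Pi.sub_apply, Pi.single_apply]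

theorem disjoint_of_dotProduct_eq_zero {ι : Type*} [Fintype ι] [DecidableEq ι] {a b c d : ι}
    (hab : a ≠ b) (hcd : c ≠ d)
    (h : (Pi.single a 1 - Pi.single b 1 : ι → ℤ) ⬝ᵥ (Pi.single c 1 - Pi.single d 1) = 0) :
    a ≠ c ∧ a ≠ d ∧ b ≠ c ∧ b ≠ d := by
  rw [single_sub_single_dotProduct] at h
  refine ⟨?_, ?_, ?_, ?_⟩ <;> rintro rfl <;> split_ifs at h <;> simp_all

/-- A copy of `A₂` spanned by two roots `u 0`, `u 1` of `A_n ⊆ ℤ^{n+1}` is supported on three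
coordinates, in a way compatible with the simple roots up to a common sign. -/
theorem exists_triple_of_A2 {ι : Type*} [Fintype ι] [DecidableEq ι] (u : Fin 2 → ι → ℤ)
    (hsum : ∀ s, ∑ k, u s k = 0) (hsq : ∀ s, u s ⬝ᵥ u s = 2) (h01 : u 0 ⬝ᵥ u 1 = -1) :
    ∃ (t : Fin 3 → ι) (ε : ℤˣ), Function.Injective t ∧
      ∀ s : Fin 2, u s = ε • (Pi.single (t s.castSucc) 1 - Pi.single (t s.succ) 1) := by
  obtain ⟨a, b, hab, h0⟩ := exists_eq_single_sub_single (u 0) (hsum 0) (hsq 0)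
  obtain ⟨c, d, hcd, h1⟩ := exists_eq_single_sub_single (u 1) (hsum 1) (hsq 1)
  rw [h0, h1, single_sub_single_dotProduct] at h01
  have hinj : ∀ x y z : ι, x ≠ y → x ≠ z → y ≠ z → Function.Injective ![x, y, z] := by
    intro x y z hxy hxz hyz p q
    fin_cases p <;> fin_cases q <;> simp [hxy, hxz, hyz, hxy.symm, hxz.symm, hyz.symm]
  by_cases hbc : b = c
  · subst hbc
    refine ⟨![a, b, d], 1, hinj _ _ _ hab ?_ hcd, ?_⟩
    · rintro rfl
      simp [hab, hab.symm] at h01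
    · intro s
      fin_cases s <;> simp [h0, h1]
  · have had : a = d := by
      by_contra had
      split_ifs at h01 <;> omega
    subst had
    refine ⟨![b, a, c], -1, hinj _ _ _ hab.symm hbc hcd.symm, ?_⟩
    intro s
    fin_cases s <;> simp [h0, h1]

theorem exists_perm_comp_eq {α β : Type*} [Finite β] {f g : α → β} (hf : Function.Injective f)
    (hg : Function.Injective g) : ∃ σ : Equiv.Perm β, ∀ a, σ (f a) = g a := by
  classical
  have := Fintype.ofFinite β
  let e : {x // x ∈ Set.range f} ≃ {x // x ∈ Set.range g} :=
    (Equiv.ofInjective f hf).symm.trans (Equiv.ofInjective g hg)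
  refine ⟨e.extendSubtype, fun a => ?_⟩
  rw [Equiv.extendSubtype_apply_of_mem e _ ⟨a, rfl⟩]
  simp only [e, Equiv.trans_apply]
  rw [show (⟨f a, ⟨a, rfl⟩⟩ : {x // x ∈ Set.range f}) = Equiv.ofInjective f hf a from rfl,
    Equiv.symm_apply_apply]
  rfl

theorem exists_injective_of_A2Pow {ℓ : ℕ} {ι : Type*} [Fintype ι] [DecidableEq ι]
    (u : Fin ℓ × Fin 2 → ι → ℤ) (hsum : ∀ p, ∑ k, u p k = 0)
    (hdot : ∀ p q, u p ⬝ᵥ u q = -A2PowMat ℓ p q) :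
    ∃ (τ : Fin ℓ × Fin 3 → ι) (ε : Fin ℓ → ℤˣ), Function.Injective τ ∧
      ∀ p, u p = ε p.1 •
        (Pi.single (τ (p.1, p.2.castSucc)) 1 - Pi.single (τ (p.1, p.2.succ)) 1) := by
  have h := fun i => exists_triple_of_A2 (fun s => u (i, s)) (fun s => hsum _)
    (fun s => by simp [hdot, A2PowMat, AMat]) (by simp [hdot, A2PowMat, AMat])
  choose t ε ht hu using h
  refine ⟨fun p => t p.1 p.2, ε, ?_, fun p => hu p.1 p.2⟩
  rintro ⟨i, s⟩ ⟨j, s'⟩ hst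
  simp only at hst
  by_cases hij : i = j
  · subst hij
    rw [ht i hst]
  exfalso
  have key : ∀ a b : Fin 2, t i a.castSucc ≠ t j b.castSucc ∧ t i a.castSucc ≠ t j b.succ ∧
      t i a.succ ≠ t j b.castSucc ∧ t i a.succ ≠ t j b.succ := by
    intro a b
    refine disjoint_of_dotProduct_eq_zero ((ht i).ne a.castSucc_lt_succ.ne)
      ((ht j).ne b.castSucc_lt_succ.ne) ?_
    have h0 := hdot (i, a) (j, b)
    simp only [hu, A2PowMat, hij, if_false, neg_zero] at h0
    simpa only [Units.smul_def, smul_dotProduct, dotProduct_smul, smul_eq_mul, mul_eq_zero,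
      Units.ne_zero, false_or] using h0
  have hedge : ∀ s : Fin 3, ∃ a : Fin 2, s = a.castSucc ∨ s = a.succ := by decide
  obtain ⟨a, rfl | rfl⟩ := hedge s <;> obtain ⟨b, rfl | rfl⟩ := hedge s'
  exacts [(key a b).1 hst, (key a b).2.1 hst, (key a b).2.2.1 hst, (key a b).2.2.2 hst]

theorem span_range_units_smul {ι M : Type*} [AddCommGroup M] (ε : ι → ℤˣ) (v : ι → M) :
    Submodule.span ℤ (Set.range fun i => ε i • v i) = Submodule.span ℤ (Set.range v) := by
  apply le_antisymm <;> rw [Submodule.span_le] <;> rintro _ ⟨i, rfl⟩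
  · exact Submodule.smul_mem _ (ε i : ℤ) (Submodule.subset_span ⟨i, rfl⟩)
  · have := Submodule.smul_mem (Submodule.span ℤ (Set.range fun i => ε i • v i))
      ((ε i)⁻¹ : ℤˣ).val (Submodule.subset_span ⟨i, rfl⟩)
    rwa [← Units.smul_def, inv_smul_smul] at this

/-- For `ℓ ≥ 1` and `n ≥ 3ℓ-1`, every primitive embedding
`φ : A₂^{⊕ℓ} → A_n` is mapped, by some element `w` of the Weyl group `W(A_n)`, onto the
standard copy of `A₂^{⊕ℓ}` generated by the `a_{3i+1}, a_{3i+2}` (`0 ≤ i ≤ ℓ-1`): the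
primitive embedding is unique up to the action of `W(A_n)`. -/
theorem statement2 (ℓ n : ℕ) (hℓ : 1 ≤ ℓ) (hn : 3 * ℓ - 1 ≤ n)
    (φ : (Fin ℓ × Fin 2 → ℤ) →ₗ[ℤ] (Fin n → ℤ))
    (hinj : Function.Injective φ)
    (hiso : ∀ x y, gram (AMat n) (φ x) (φ y) = gram (A2PowMat ℓ) x y)
    (hprim : NoZeroSMulDivisors ℤ ((Fin n → ℤ) ⧸ LinearMap.range φ)) :
    ∃ w : (Fin n → ℤ) ≃ₗ[ℤ] (Fin n → ℤ), w ∈ weylGroup (gram (AMat n)) ∧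
      Submodule.map (w : (Fin n → ℤ) →ₗ[ℤ] (Fin n → ℤ)) (LinearMap.range φ) =
        Submodule.span ℤ (Set.range (stdGen ℓ n)) := by
  obtain ⟨τ, ε, hτ, hu⟩ := exists_injective_of_A2Pow
    (fun p => toCoords n (φ (Pi.single p 1))) (fun p => sum_toCoords _) (fun p q => by
      have h := hiso (Pi.single p 1) (Pi.single q 1)
      rw [gram_AMat_eq_neg_dotProduct] at h
      rw [← neg_neg (_ ⬝ᵥ _), h]
      rw [gram_single_single])
  let τ₀ : Fin ℓ × Fin 3 → Fin (n + 1) := fun p => ⟨3 * p.1 + p.2, by omega⟩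
  have hτ₀ : Function.Injective τ₀ := by
    rintro ⟨i, s⟩ ⟨j, s'⟩ h
    simp only [τ₀, Fin.mk.injEq] at h
    ext <;> simp only <;> omega
  obtain ⟨σ, hσ⟩ := exists_perm_comp_eq hτ₀ hτ
  obtain ⟨w, hw, hwx⟩ := exists_weylGroup_comp_perm σ
  have hstd : ∀ p, w (φ (Pi.single p 1)) = ε p.1 • stdGen ℓ n p := by
    rintro ⟨i, s⟩
    apply toCoords_injective n
    have hlt : 3 * (i : ℕ) + s < n := by omega
    have hgen : stdGen ℓ n (i, s) = Pi.single ⟨3 * i + s, hlt⟩ 1 := by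
      ext j
      simp [stdGen, Pi.single_apply, Fin.ext_iff]
    have hu' := hu (i, s)
    simp only [← hσ] at hu'
    rw [hwx, hu', hgen, Units.smul_def, Units.smul_def, map_smul, toCoords_single]
    ext k
    simp [Pi.single_apply, σ.injective.eq_iff, τ₀, Fin.ext_iff, add_assoc]
  refine ⟨w, hw, ?_⟩
  rw [← span_range_units_smul (fun p : Fin ℓ × Fin 2 => ε p.1), LinearMap.range_eq_map,
    ← (Pi.basisFun ℤ (Fin ℓ × Fin 2)).span_eq, Submodule.map_span, Submodule.map_span,
    ← Set.range_comp, ← Set.range_comp]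
  congr 2
  ext1 p
  simp [hstd]

end Paper
end

section
/- The negative definite root lattice E₆ and the positive definite lattice A₂(−1) (ℤ² with Gram matrix [[2,−1],[−1,2]]) have isomorphic discriminant lattices: there is a group isomorphism G_{E₆} ≅ G_{A₂(−1)} that commutes with the discriminant forms q with values in ℚ/2ℤ. -/
namespace Paper

/-- The `ℚ`-bilinear form on `ι → ℚ` with Gram matrix `M`. -/
def Bq {ι : Type*} [Fintype ι] (M : Matrix ι ι ℚ) (x y : ι → ℚ) : ℚ :=
  ∑ i, ∑ j, x i * M i j * y j

/-- The standard copy of the lattice `L = ℤ^ι` inside `L ⊗ ℚ = ℚ^ι`, as a `ℤ`-submodule. -/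
def intLat (ι : Type*) [Fintype ι] [DecidableEq ι] : Submodule ℤ (ι → ℚ) :=
  Submodule.span ℤ (Set.range fun i : ι => Pi.single i (1 : ℚ))

/-- The dual lattice `L^∨ = {x ∈ L ⊗ ℚ : ⟨x,l⟩ ∈ ℤ for all l ∈ L}` of the lattice with
Gram matrix `M`. -/
def dualLat {ι : Type*} [Fintype ι] [DecidableEq ι] (M : Matrix ι ι ℚ) :
    Submodule ℤ (ι → ℚ) where
  carrier := {x | ∀ l ∈ intLat ι, ∃ k : ℤ, Bq M x l = k}
  add_mem' := by
    intro a b ha hb l hl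
    obtain ⟨k₁, h₁⟩ := ha l hl
    obtain ⟨k₂, h₂⟩ := hb l hl
    refine ⟨k₁ + k₂, ?_⟩
    have h : Bq M (a + b) l = Bq M a l + Bq M b l := by
      simp [Bq, add_mul, Finset.sum_add_distrib]
    rw [h, h₁, h₂]; push_cast; ring
  zero_mem' := by
    intro l hl
    exact ⟨0, by simp [Bq]⟩
  smul_mem' := by
    intro c a ha l hl
    obtain ⟨k, h⟩ := ha l hl
    refine ⟨c * k, ?_⟩
    have hs : Bq M (c • a) l = (c : ℚ) * Bq M a l := by
      simp [Bq, Finset.mul_sum, mul_assoc]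
    rw [hs, h]; push_cast; ring

/-- The discriminant group `G_L = L^∨/L` of the lattice with Gram matrix `M`. -/
abbrev discGroup {ι : Type*} [Fintype ι] [DecidableEq ι] (M : Matrix ι ι ℚ) :=
  ↥(dualLat M) ⧸ (intLat ι).comap (dualLat M).subtype

/-- The class in the discriminant group `G_L = L^∨/L` of an element of `L^∨`. -/
def discMk {ι : Type*} [Fintype ι] [DecidableEq ι] (M : Matrix ι ι ℚ)
    (x : ↥(dualLat M)) : discGroup M :=
  Submodule.Quotient.mk x
/-- The Gram matrix (over `ℚ`) of the negative definite root lattice `E_n` (`n = 6,7,8`):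
basis `e₁, …, e_n` (`0`-based indices here), `⟨eᵢ,eᵢ⟩ = -2`, `⟨eᵢ,eⱼ⟩ = 1` exactly when
`{i,j}` is an edge of the Dynkin diagram given by the chain `e₂–e₃–⋯–e_n` together with
`e₁` joined to `e₄`, and `0` otherwise. -/
def EMatQ (n : ℕ) : Matrix (Fin n) (Fin n) ℚ := fun i j =>
  if i = j then -2
  else if (1 ≤ (i : ℕ) ∧ (i : ℕ) + 1 = (j : ℕ)) ∨ (1 ≤ (j : ℕ) ∧ (j : ℕ) + 1 = (i : ℕ))
      ∨ ((i : ℕ) = 0 ∧ (j : ℕ) = 3) ∨ ((i : ℕ) = 3 ∧ (j : ℕ) = 0) then 1 else 0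

/-- The Gram matrix of the positive definite lattice `A₂(-1)`. -/
def A2NegMat : Matrix (Fin 2) (Fin 2) ℚ := !![2, -1; -1, 2]

theorem mem_intLat_iff {ι : Type*} [Fintype ι] [DecidableEq ι] {x : ι → ℚ} :
    x ∈ intLat ι ↔ ∃ z : ι → ℤ, ∀ i, x i = z i := by
  rw [intLat, Submodule.mem_span_range_iff_exists_fun]
  have key (c : ι → ℤ) : ∑ i, c i • (Pi.single i (1 : ℚ) : ι → ℚ) = fun i => (c i : ℚ) := by
    ext j
    simp [Finset.sum_apply, Pi.single_apply]
  simp only [key, funext_iff, eq_comm]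

theorem single_mem_intLat {ι : Type*} [Fintype ι] [DecidableEq ι] (i : ι) :
    Pi.single i (1 : ℚ) ∈ intLat ι :=
  Submodule.subset_span ⟨i, rfl⟩

/-- Pairing integrally with the standard basis vectors means lying in the dual lattice. -/
theorem mem_dualLat_iff {ι : Type*} [Fintype ι] [DecidableEq ι] {M : Matrix ι ι ℚ} {x : ι → ℚ} :
    x ∈ dualLat M ↔ ∃ n : ι → ℤ, ∀ j, ∑ i, x i * M i j = n j := by
  constructor
  · intro hx
    have h (j : ι) : ∃ k : ℤ, ∑ i, x i * M i j = k := by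
      obtain ⟨k, hk⟩ := hx _ (single_mem_intLat j)
      exact ⟨k, by simpa [Bq, Pi.single_apply] using hk⟩
    choose n hn using h
    exact ⟨n, hn⟩
  · rintro ⟨n, hn⟩ l hl
    obtain ⟨z, hz⟩ := mem_intLat_iff.1 hl
    refine ⟨∑ j, n j * z j, ?_⟩
    rw [Bq, Finset.sum_comm]
    push_cast
    refine Finset.sum_congr rfl fun j _ => ?_
    rw [← Finset.sum_mul, hn, hz]

theorem discMk_eq_discMk_iff {ι : Type*} [Fintype ι] [DecidableEq ι] {M : Matrix ι ι ℚ}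
    {x y : dualLat M} : discMk M x = discMk M y ↔ x.1 - y.1 ∈ intLat ι := by
  rw [discMk, discMk, Submodule.Quotient.eq]
  rfl

theorem discMk_zsmul {ι : Type*} [Fintype ι] [DecidableEq ι] {M : Matrix ι ι ℚ}
    (k : ℤ) (x : dualLat M) : k • discMk M x = discMk M (k • x) :=
  rfl

theorem discMk_zsmul_eq_zero_iff {ι : Type*} [Fintype ι] [DecidableEq ι] {M : Matrix ι ι ℚ}
    (k : ℤ) (x : dualLat M) : k • discMk M x = 0 ↔ ∃ z : ι → ℤ, ∀ i, k * x.1 i = z i := by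
  rw [discMk_zsmul, show (0 : discGroup M) = discMk M 0 from rfl, discMk_eq_discMk_iff,
    mem_intLat_iff]
  simp

/-- Two groups generated by single elements of the same order are isomorphic by a map matching the
generators. -/
theorem exists_addEquiv_zsmul_eq {G H : Type*} [AddCommGroup G] [AddCommGroup H] {g : G} {h : H}
    (hg : ∀ a : G, ∃ k : ℤ, k • g = a) (hh : ∀ b : H, ∃ k : ℤ, k • h = b)
    (hk : ∀ k : ℤ, k • g = 0 ↔ k • h = 0) :
    ∃ f : G ≃+ H, ∀ k : ℤ, f (k • g) = k • h := by
  let φ := zmultiplesHom G g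
  let ψ := zmultiplesHom H h
  have hker : φ.ker = ψ.ker := by
    ext k
    simpa [φ, ψ, AddMonoidHom.mem_ker] using hk k
  refine ⟨((QuotientAddGroup.quotientKerEquivOfSurjective φ hg).symm.trans
    (QuotientAddGroup.quotientAddEquivOfEq hker)).trans
    (QuotientAddGroup.quotientKerEquivOfSurjective ψ hh), fun k => ?_⟩
  have : (QuotientAddGroup.quotientKerEquivOfSurjective φ hg).symm (k • g) =
      (k : ℤ ⧸ φ.ker) := by
    rw [AddEquiv.symm_apply_eq]
    rfl
  simp only [AddEquiv.trans_apply, this]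
  rfl

/-- A representative of a generator of the discriminant group of `E₆`. -/
def e6Glue : Fin 6 → ℚ := ![0, 1 / 3, 2 / 3, 0, 1 / 3, 2 / 3]

/-- A representative of a generator of the discriminant group of `A₂(-1)`. -/
def a2Glue : Fin 2 → ℚ := ![1 / 3, 2 / 3]

theorem eMatQ_six : EMatQ 6 = !![-2, 0, 0, 1, 0, 0; 0, -2, 1, 0, 0, 0; 0, 1, -2, 1, 0, 0;
    1, 0, 1, -2, 1, 0; 0, 0, 0, 1, -2, 1; 0, 0, 0, 0, 1, -2] := by
  ext i j
  fin_cases i <;> fin_cases j <;> simp [EMatQ]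

theorem e6Glue_mem : e6Glue ∈ dualLat (EMatQ 6) := by
  refine mem_dualLat_iff.2 ⟨![0, 0, -1, 1, 0, -1], fun j => ?_⟩
  rw [eMatQ_six]
  fin_cases j <;> simp [e6Glue, Fin.sum_univ_succ] <;> norm_num

theorem a2Glue_mem : a2Glue ∈ dualLat A2NegMat := by
  refine mem_dualLat_iff.2 ⟨![0, 1], fun j => ?_⟩
  fin_cases j <;> simp [a2Glue, A2NegMat] <;> norm_num

theorem exists_zsmul_e6Glue_add {x : Fin 6 → ℚ} (hx : x ∈ dualLat (EMatQ 6)) :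
    ∃ k : ℤ, ∃ z : Fin 6 → ℤ, ∀ i, x i = k * e6Glue i + z i := by
  obtain ⟨n, hn⟩ := mem_dualLat_iff.1 hx
  rw [eMatQ_six] at hn
  simp [Fin.forall_fin_succ, Fin.sum_univ_succ] at hn
  refine ⟨-(n 1 + 2 * n 2 + n 4 + 2 * n 5),
    ![-(2 * n 0 + n 1 + 2 * n 2 + 3 * n 3 + 2 * n 4 + n 5),
      -(n 0 + n 1 + n 2 + 2 * n 3 + n 4),
      -(2 * n 0 + n 1 + 2 * n 2 + 4 * n 3 + 2 * n 4),
      -(3 * n 0 + 2 * n 1 + 4 * n 2 + 6 * n 3 + 4 * n 4 + 2 * n 5),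
      -(2 * n 0 + n 1 + 2 * n 2 + 4 * n 3 + 3 * n 4 + n 5),
      -(n 0 + 2 * n 3 + n 4)], ?_⟩
  simp [Fin.forall_fin_succ, e6Glue]
  obtain ⟨h0, h1, h2, h3, h4, h5⟩ := hn
  refine ⟨?_, ?_, ?_, ?_, ?_, ?_⟩ <;> linarith

theorem exists_zsmul_a2Glue_add {x : Fin 2 → ℚ} (hx : x ∈ dualLat A2NegMat) :
    ∃ k : ℤ, ∃ z : Fin 2 → ℤ, ∀ i, x i = k * a2Glue i + z i := by
  obtain ⟨n, hn⟩ := mem_dualLat_iff.1 hx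
  simp [A2NegMat] at hn
  refine ⟨2 * n 0 + n 1, ![0, -n 0], ?_⟩
  simp [a2Glue]
  constructor <;> linarith

theorem exists_intCast_mul_e6Glue_iff (k : ℤ) :
    (∃ z : Fin 6 → ℤ, ∀ i, k * e6Glue i = z i) ↔ 3 ∣ k := by
  constructor
  · rintro ⟨z, hz⟩
    have h := hz 1
    simp [e6Glue] at h
    exact ⟨z 1, by exact_mod_cast (by linarith : (k : ℚ) = 3 * z 1)⟩
  · rintro ⟨m, rfl⟩
    refine ⟨![0, m, 2 * m, 0, m, 2 * m], ?_⟩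
    simp [Fin.forall_fin_succ, e6Glue]
    refine ⟨?_, ?_, ?_, ?_⟩ <;> ring

theorem exists_intCast_mul_a2Glue_iff (k : ℤ) :
    (∃ z : Fin 2 → ℤ, ∀ i, k * a2Glue i = z i) ↔ 3 ∣ k := by
  constructor
  · rintro ⟨z, hz⟩
    have h := hz 0
    simp [a2Glue] at h
    exact ⟨z 0, by exact_mod_cast (by linarith : (k : ℚ) = 3 * z 0)⟩
  · rintro ⟨m, rfl⟩
    refine ⟨![m, 2 * m], ?_⟩
    simp [a2Glue]
    constructor <;> ring

theorem Bq_e6_glue_add {x : Fin 6 → ℚ} {k : ℤ} {z : Fin 6 → ℤ}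
    (hx : ∀ i, x i = k * e6Glue i + z i) :
    ∃ m : ℤ, Bq (EMatQ 6) x x = -(4 / 3) * k ^ 2 + 2 * m := by
  refine ⟨k * (-z 2 + z 3 - z 5) - (z 0 ^ 2 + z 1 ^ 2 + z 2 ^ 2 + z 3 ^ 2 + z 4 ^ 2 + z 5 ^ 2)
    + z 0 * z 3 + z 1 * z 2 + z 2 * z 3 + z 3 * z 4 + z 4 * z 5, ?_⟩
  simp only [Bq, hx, eMatQ_six]
  simp [Fin.sum_univ_succ, e6Glue]
  ring

theorem Bq_a2_glue_add {y : Fin 2 → ℚ} {k : ℤ} {z : Fin 2 → ℤ}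
    (hy : ∀ i, y i = k * a2Glue i + z i) :
    ∃ m : ℤ, Bq A2NegMat y y = 2 / 3 * k ^ 2 + 2 * m := by
  refine ⟨k * z 1 + z 0 ^ 2 - z 0 * z 1 + z 1 ^ 2, ?_⟩
  simp only [Bq, hy]
  simp [A2NegMat, a2Glue]
  ring

/-- The lattices `E₆` (negative definite) and `A₂(-1)` have isomorphic
discriminant lattices: there is a group isomorphism `G_{E₆} ≃ G_{A₂(-1)}` commuting with
the discriminant forms (for representatives `x, y` of corresponding classes,
`⟨y,y⟩ ≡ ⟨x,x⟩ mod 2ℤ`). -/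
theorem statement7 :
    ∃ f : discGroup (EMatQ 6) ≃+ discGroup A2NegMat,
      ∀ (x : ↥(dualLat (EMatQ 6))) (y : ↥(dualLat A2NegMat)),
        f (discMk (EMatQ 6) x) = discMk A2NegMat y →
        ∃ m : ℤ, Bq A2NegMat y.1 y.1 - Bq (EMatQ 6) x.1 x.1 = 2 * m := by
  have hg (a : discGroup (EMatQ 6)) : ∃ k : ℤ, k • discMk (EMatQ 6) ⟨e6Glue, e6Glue_mem⟩ = a := by
    obtain ⟨x, rfl⟩ := Submodule.Quotient.mk_surjective _ a
    obtain ⟨k, z, h⟩ := exists_zsmul_e6Glue_add x.2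
    refine ⟨k, discMk_eq_discMk_iff.2 (mem_intLat_iff.2 ⟨-z, fun i => ?_⟩)⟩
    simp [h]
  have hh (b : discGroup A2NegMat) : ∃ k : ℤ, k • discMk A2NegMat ⟨a2Glue, a2Glue_mem⟩ = b := by
    obtain ⟨y, rfl⟩ := Submodule.Quotient.mk_surjective _ b
    obtain ⟨k, z, h⟩ := exists_zsmul_a2Glue_add y.2
    refine ⟨k, discMk_eq_discMk_iff.2 (mem_intLat_iff.2 ⟨-z, fun i => ?_⟩)⟩
    simp [h]
  obtain ⟨f, hf⟩ := exists_addEquiv_zsmul_eq hg hh fun k => by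
    rw [discMk_zsmul_eq_zero_iff, discMk_zsmul_eq_zero_iff, exists_intCast_mul_e6Glue_iff,
      exists_intCast_mul_a2Glue_iff]
  refine ⟨f, fun x y hxy => ?_⟩
  obtain ⟨k, hk⟩ := hg (discMk _ x)
  rw [← hk, hf, discMk_zsmul, eq_comm, discMk_eq_discMk_iff, mem_intLat_iff] at hxy
  rw [discMk_zsmul, eq_comm, discMk_eq_discMk_iff, mem_intLat_iff] at hk
  obtain ⟨z, hz⟩ := hk
  obtain ⟨w, hw⟩ := hxy
  obtain ⟨a, ha⟩ := Bq_e6_glue_add (x := x.1) (k := k) (z := z) fun i => by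
    have := hz i
    simp at this
    linarith
  obtain ⟨b, hb⟩ := Bq_a2_glue_add (y := y.1) (k := k) (z := w) fun i => by
    have := hw i
    simp at this
    linarith
  refine ⟨k ^ 2 + b - a, ?_⟩
  rw [ha, hb]
  push_cast
  ring

end Paper
end

section
/- The even lattices U ⊕ U(3) ⊕ A₂^{⊕3} and E₆ ⊕ A₂^{⊕4} (with A₂ and E₆ negative definite) have isomorphic discriminant lattices: their discriminant groups are both isomorphic to (ℤ/3ℤ)⁵ and there is a group isomorphism between them commuting with the discriminant forms q with values in ℚ/2ℤ. -/
namespace Paper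

/-- The Gram matrix of the even lattice `U ⊕ U(3)`, in the basis `u₁, u₂, u′₁, u′₂`. -/
def UU3Mat : Matrix (Fin 4) (Fin 4) ℚ := !![0, 1, 0, 0; 1, 0, 0, 0; 0, 0, 0, 3; 0, 0, 3, 0]

/-- The Gram matrix of the negative definite root lattice `A₂`. -/
def A2MatQ : Matrix (Fin 2) (Fin 2) ℚ := !![-2, 1; 1, -2]

/-- The Gram matrix of the orthogonal direct sum `A₂^{⊕ℓ}` (negative definite). -/
def A2PowMatQ (ℓ : ℕ) : Matrix (Fin ℓ × Fin 2) (Fin ℓ × Fin 2) ℚ := fun p q =>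
  if p.1 = q.1 then A2MatQ p.2 q.2 else 0

/-- The Gram matrix of `U ⊕ U(3) ⊕ A₂^{⊕3}`. -/
def UU3A23Mat : Matrix (Fin 4 ⊕ Fin 3 × Fin 2) (Fin 4 ⊕ Fin 3 × Fin 2) ℚ :=
  Matrix.fromBlocks UU3Mat 0 0 (A2PowMatQ 3)

/-- The Gram matrix of `E₆ ⊕ A₂^{⊕4}` (negative definite). -/
def E6A24Mat : Matrix (Fin 6 ⊕ Fin 4 × Fin 2) (Fin 6 ⊕ Fin 4 × Fin 2) ℚ :=
  Matrix.fromBlocks (EMatQ 6) 0 0 (A2PowMatQ 4)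

section Lattice

variable {ι κ : Type*} [Fintype ι] [DecidableEq ι] [Fintype κ] [DecidableEq κ]

theorem mem_intLat {x : ι → ℚ} : x ∈ intLat ι ↔ ∀ i, ∃ k : ℤ, x i = k := by
  constructor
  · intro hx
    induction hx using Submodule.span_induction with
    | mem y hy =>
      obtain ⟨j, rfl⟩ := hy
      intro i
      by_cases h : i = j
      · subst h
        exact ⟨1, by simp⟩
      · exact ⟨0, by simp [h]⟩
    | zero => exact fun i => ⟨0, by simp⟩
    | add y z _ _ hy hz =>
      intro i
      obtain ⟨k, hk⟩ := hy i
      obtain ⟨l, hl⟩ := hz i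
      exact ⟨k + l, by simp [hk, hl]⟩
    | smul c y _ hy =>
      intro i
      obtain ⟨k, hk⟩ := hy i
      exact ⟨c * k, by simp [hk]⟩
  · intro h
    choose k hk using h
    have hx : x = ∑ i, k i • Pi.single i (1 : ℚ) := by
      ext j
      simp [Finset.sum_apply, Pi.single_apply, hk]
    rw [hx]
    exact Submodule.sum_mem _ fun i _ =>
      Submodule.smul_mem _ _ (Submodule.subset_span ⟨i, rfl⟩)

theorem mem_dualLat {M : Matrix ι ι ℚ} {x : ι → ℚ} :
    x ∈ dualLat M ↔ ∀ j, ∃ k : ℤ, ∑ i, x i * M i j = k := by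
  constructor
  · intro hx j
    obtain ⟨k, hk⟩ := hx (Pi.single j 1) (Submodule.subset_span ⟨j, rfl⟩)
    exact ⟨k, by simpa [Bq, Pi.single_apply] using hk⟩
  · intro h l hl
    choose k hk using h
    choose m hm using mem_intLat.1 hl
    refine ⟨∑ j, k j * m j, ?_⟩
    rw [Bq, Finset.sum_comm]
    push_cast
    exact Finset.sum_congr rfl fun j _ => by rw [← Finset.sum_mul, hk, hm]

theorem mem_dualLat_fromBlocks {A : Matrix ι ι ℚ} {D : Matrix κ κ ℚ} {x : ι ⊕ κ → ℚ} :
    x ∈ dualLat (Matrix.fromBlocks A 0 0 D) ↔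
      (fun i => x (Sum.inl i)) ∈ dualLat A ∧ (fun i => x (Sum.inr i)) ∈ dualLat D := by
  simp [mem_dualLat]

omit [DecidableEq ι] [DecidableEq κ] in
theorem Bq_fromBlocks (A : Matrix ι ι ℚ) (D : Matrix κ κ ℚ) (x y : ι ⊕ κ → ℚ) :
    Bq (Matrix.fromBlocks A 0 0 D) x y =
      Bq A (fun i => x (Sum.inl i)) (fun i => y (Sum.inl i)) +
        Bq D (fun i => x (Sum.inr i)) (fun i => y (Sum.inr i)) := by
  simp [Bq]

theorem mem_dualLat_A2PowMatQ {ℓ : ℕ} {x : Fin ℓ × Fin 2 → ℚ} :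
    x ∈ dualLat (A2PowMatQ ℓ) ↔ ∀ p, (fun q => x (p, q)) ∈ dualLat A2MatQ := by
  simp only [mem_dualLat, Prod.forall, A2PowMatQ, Fintype.sum_prod_type_right, mul_ite, mul_zero,
    Finset.sum_ite_eq', Finset.mem_univ, if_true]

theorem Bq_A2PowMatQ (ℓ : ℕ) (x y : Fin ℓ × Fin 2 → ℚ) :
    Bq (A2PowMatQ ℓ) x y = ∑ p, Bq A2MatQ (fun q => x (p, q)) (fun q => y (p, q)) := by
  simp only [Bq, A2PowMatQ, Fintype.sum_prod_type, mul_ite, ite_mul, mul_zero, zero_mul]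
  refine Finset.sum_congr rfl fun p _ => Finset.sum_congr rfl fun q _ => ?_
  rw [Finset.sum_comm]
  simp

theorem mem_dualLat_A2MatQ {x : Fin 2 → ℚ} :
    x ∈ dualLat A2MatQ ↔ ∃ t r : ℤ, x 0 = t / 3 ∧ x 1 = 2 * t / 3 + r := by
  simp only [mem_dualLat, Fin.forall_fin_two, Fin.sum_univ_two, A2MatQ]
  simp only [Matrix.of_apply, Matrix.cons_val]
  constructor
  · rintro ⟨⟨k, hk⟩, l, hl⟩
    exact ⟨-2 * k - l, k, by push_cast; linarith, by push_cast; linarith⟩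
  · rintro ⟨t, r, h₀, h₁⟩
    exact ⟨⟨r, by rw [h₀, h₁]; ring⟩, -t - 2 * r, by rw [h₀, h₁]; push_cast; ring⟩

theorem mem_dualLat_UU3Mat {x : Fin 4 → ℚ} :
    x ∈ dualLat UU3Mat ↔
      ∃ a b p q : ℤ, x 0 = a ∧ x 1 = b ∧ x 2 = p / 3 ∧ x 3 = q / 3 := by
  simp only [mem_dualLat, Fin.forall_fin_succ, Fin.sum_univ_succ, UU3Mat]
  simp
  constructor
  · rintro ⟨⟨b, hb⟩, ⟨a, ha⟩, ⟨q, hq⟩, p, hp⟩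
    exact ⟨⟨a, ha⟩, ⟨b, hb⟩, ⟨p, by linarith⟩, q, by linarith⟩
  · rintro ⟨⟨a, ha⟩, ⟨b, hb⟩, ⟨p, hp⟩, q, hq⟩
    exact ⟨⟨b, hb⟩, ⟨a, ha⟩, ⟨q, by linarith⟩, p, by linarith⟩

theorem mem_dualLat_EMatQ_six {x : Fin 6 → ℚ} :
    x ∈ dualLat (EMatQ 6) ↔
      ∃ t a b c d e : ℤ, x 0 = a ∧ x 1 = t / 3 ∧ x 2 = 2 * t / 3 + b ∧ x 3 = c ∧
        x 4 = t / 3 + d ∧ x 5 = 2 * t / 3 + e := by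
  simp only [mem_dualLat, Fin.forall_fin_succ, Fin.sum_univ_succ, EMatQ]
  simp
  constructor
  · rintro ⟨⟨k₀, h₀⟩, ⟨k₁, h₁⟩, ⟨k₂, h₂⟩, ⟨k₃, h₃⟩, ⟨k₄, h₄⟩, k₅, h₅⟩
    refine ⟨⟨-(2 * k₀ + k₁ + 2 * k₂ + 3 * k₃ + 2 * k₄ + k₅), ?_⟩,
      -(3 * k₀ + 4 * k₁ + 5 * k₂ + 6 * k₃ + 4 * k₄ + 2 * k₅), ?_, ⟨k₁, ?_⟩,
      ⟨-(3 * k₀ + 2 * k₁ + 4 * k₂ + 6 * k₃ + 4 * k₄ + 2 * k₅), ?_⟩,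
      ⟨-(k₀ + k₂ + 2 * k₃ + 2 * k₄ + k₅), ?_⟩, ⟨k₀ + 2 * k₁ + 2 * k₂ + 2 * k₃ + k₄, ?_⟩⟩ <;>
      push_cast <;> linarith
  · rintro ⟨⟨a, h₀⟩, t, h₁, ⟨b, h₂⟩, ⟨c, h₃⟩, ⟨d, h₄⟩, e, h₅⟩
    refine ⟨⟨c - 2 * a, ?_⟩, ⟨b, ?_⟩, ⟨c - 2 * b - t, ?_⟩, ⟨a + b - 2 * c + d + t, ?_⟩,
      ⟨c - 2 * d + e, ?_⟩, d - 2 * e - t, ?_⟩ <;>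
      push_cast <;> linarith

theorem Bq_A2MatQ_self {x : Fin 2 → ℚ} (hx : x ∈ dualLat A2MatQ) {t : ℤ} (ht : 3 * x 0 = t) :
    ∃ m : ℤ, Bq A2MatQ x x = -(2 / 3) * t ^ 2 + 2 * m := by
  obtain ⟨s, r, h₀, h₁⟩ := mem_dualLat_A2MatQ.1 hx
  obtain rfl : t = s := by
    have : (t : ℚ) = s := by linarith
    exact_mod_cast this
  refine ⟨-(t * r + r ^ 2), ?_⟩
  simp [Bq, A2MatQ, Fin.sum_univ_two, h₀, h₁]
  ring

theorem Bq_UU3Mat_self {x : Fin 4 → ℚ} (hx : x ∈ dualLat UU3Mat) {u v : ℤ}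
    (hu : 3 * x 2 + 3 * x 3 = u) (hv : 3 * x 2 - 3 * x 3 = v) :
    ∃ m : ℤ, Bq UU3Mat x x = 2 / 3 * u ^ 2 - 2 / 3 * v ^ 2 + 2 * m := by
  obtain ⟨a, b, p, q, h₀, h₁, h₂, h₃⟩ := mem_dualLat_UU3Mat.1 hx
  refine ⟨a * b - p * q, ?_⟩
  rw [← hu, ← hv]
  simp [Bq, UU3Mat, Fin.sum_univ_succ, h₀, h₁, h₂, h₃]
  ring

theorem Bq_EMatQ_six_self {x : Fin 6 → ℚ} (hx : x ∈ dualLat (EMatQ 6)) {t : ℤ}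
    (ht : 3 * x 1 = t) :
    ∃ m : ℤ, Bq (EMatQ 6) x x = 2 / 3 * t ^ 2 + 2 * m := by
  obtain ⟨s, a, b, c, d, e, h₀, h₁, h₂, h₃, h₄, h₅⟩ := mem_dualLat_EMatQ_six.1 hx
  obtain rfl : t = s := by
    have : (t : ℚ) = s := by linarith
    exact_mod_cast this
  refine ⟨-t ^ 2 + t * (-b + c - e) - (a ^ 2 + b ^ 2 + c ^ 2 + d ^ 2 + e ^ 2) +
    b * c + c * d + d * e + a * c, ?_⟩
  simp only [Bq, EMatQ, Fin.sum_univ_succ]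
  simp
  rw [h₀, h₁, h₂, h₃, h₄, h₅]
  ring

/-- Additive functionals `ℓ` that are integral on the dual lattice, attain all integral values
modulo `n` there, and are divisible by `n` exactly on the lattice, induce coordinates modulo `n` on the
discriminant group. -/
theorem exists_discGroup_addEquiv {m n : ℕ} (M : Matrix ι ι ℚ) (ℓ : Fin m → (ι → ℚ) →+ ℚ)
    (hint : ∀ x ∈ dualLat M, ∀ i, ∃ k : ℤ, ℓ i x = k)
    (hker : ∀ x ∈ dualLat M, x ∈ intLat ι ↔ ∀ i, ∃ k : ℤ, ℓ i x = n * k)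
    (hsurj : ∀ c : Fin m → ℤ, ∃ x ∈ dualLat M, ∀ i, ∃ k : ℤ, ℓ i x = c i + n * k) :
    ∃ e : discGroup M ≃+ (Fin m → ZMod n),
      ∀ (x : dualLat M) (c : Fin m → ℤ), (∀ i, ℓ i x = c i) →
        ∀ i, e (discMk M x) i = c i := by
  choose k hk using fun (x : dualLat M) i => hint x.1 x.2 i
  let φ : dualLat M →+ (Fin m → ZMod n) :=
    { toFun := fun x i => (k x i : ZMod n)
      map_zero' := by
        ext i
        have : (k 0 i : ℚ) = 0 := by rw [← hk]; simp
        have : k 0 i = 0 := by exact_mod_cast this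
        simp [this]
      map_add' := fun x y => by
        ext i
        have : (k (x + y) i : ℚ) = k x i + k y i := by rw [← hk, ← hk, ← hk]; simp
        have : k (x + y) i = k x i + k y i := by exact_mod_cast this
        simp [this] }
  have hφ : ∀ x i, φ x i = (k x i : ZMod n) := fun _ _ => rfl
  have hφ_ker : ∀ x : dualLat M, φ x = 0 ↔ x ∈ (intLat ι).comap (dualLat M).subtype := by
    intro x
    rw [Submodule.mem_comap, Submodule.subtype_apply, hker x.1 x.2, funext_iff]
    refine forall_congr' fun i => ?_
    rw [hφ, Pi.zero_apply, ZMod.intCast_zmod_eq_zero_iff_dvd, hk]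
    refine exists_congr fun c => ?_
    norm_cast
  have hφ_coe : ∀ (x : dualLat M) (c : Fin m → ℤ), (∀ i, ℓ i x = c i) → ∀ i, φ x i = c i := by
    intro x c hc i
    have : (k x i : ℚ) = c i := by rw [← hk, hc]
    rw [hφ, show k x i = c i by exact_mod_cast this]
  let ψ : discGroup M →ₗ[ℤ] (Fin m → ZMod n) :=
    Submodule.liftQ _ φ.toIntLinearMap fun x hx => (hφ_ker x).2 hx
  have hψ : ∀ x, ψ (discMk M x) = φ x := fun _ => rfl
  have hbij : Function.Bijective ψ := by
    constructor
    · rw [injective_iff_map_eq_zero]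
      intro a ha
      obtain ⟨x, rfl⟩ := Submodule.Quotient.mk_surjective _ a
      exact (Submodule.Quotient.mk_eq_zero _).2 ((hφ_ker x).1 ha)
    · intro c
      choose d hd using fun i => ZMod.intCast_surjective (c i)
      obtain ⟨x, hx, hxd⟩ := hsurj d
      choose l hl using hxd
      refine ⟨discMk M ⟨x, hx⟩, funext fun i => ?_⟩
      rw [hψ, hφ_coe ⟨x, hx⟩ (fun i => d i + n * l i) (fun i => by simp [hl]), ← hd]
      simp
  exact ⟨AddEquiv.ofBijective ψ.toAddMonoidHom hbij, hφ_coe⟩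

end Lattice

/-- Evaluation at a coordinate, multiplied by `3`. -/
def threeCoord {ι : Type*} (i : ι) : (ι → ℚ) →+ ℚ :=
  (AddMonoidHom.mulLeft 3).comp (Pi.evalAddMonoidHom (fun _ : ι => ℚ) i)

theorem threeCoord_apply {ι : Type*} (i : ι) (x : ι → ℚ) : threeCoord i x = 3 * x i := rfl

/-- The quadratic form `2/3 (c₀² - c₁² - c₂² - c₃² - c₄²)` on `ℤ⁵`, which induces both
discriminant forms. -/
def modelForm (c : Fin 5 → ℤ) : ℚ :=
  2 / 3 * (c 0 ^ 2 - c 1 ^ 2 - c 2 ^ 2 - c 3 ^ 2 - c 4 ^ 2)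

theorem modelForm_congr {c d : Fin 5 → ℤ} (h : ∀ i, (c i : ZMod 3) = d i) :
    ∃ m : ℤ, modelForm d - modelForm c = 2 * m := by
  have hdvd : ∀ i, ∃ k, d i = c i + 3 * k := fun i => by
    obtain ⟨k, hk⟩ := (ZMod.intCast_eq_intCast_iff_dvd_sub _ _ 3).1 (h i)
    exact ⟨k, by push_cast at hk; linarith⟩
  choose k hk using hdvd
  refine ⟨(2 * c 0 * k 0 + 3 * k 0 ^ 2) - (2 * c 1 * k 1 + 3 * k 1 ^ 2) -
    (2 * c 2 * k 2 + 3 * k 2 ^ 2) - (2 * c 3 * k 3 + 3 * k 3 ^ 2) -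
    (2 * c 4 * k 4 + 3 * k 4 ^ 2), ?_⟩
  simp only [modelForm, hk]
  push_cast
  ring

theorem exists_discGroup_UU3A23Mat_addEquiv :
    ∃ e : discGroup UU3A23Mat ≃+ (Fin 5 → ZMod 3), ∀ x : dualLat UU3A23Mat,
      ∃ (c : Fin 5 → ℤ) (m : ℤ), (∀ i, e (discMk UU3A23Mat x) i = c i) ∧
        Bq UU3A23Mat x.1 x.1 = modelForm c + 2 * m := by
  let ℓ : Fin 5 → (Fin 4 ⊕ Fin 3 × Fin 2 → ℚ) →+ ℚ :=
    ![threeCoord (Sum.inl 2) + threeCoord (Sum.inl 3),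
      threeCoord (Sum.inl 2) - threeCoord (Sum.inl 3),
      threeCoord (Sum.inr (0, 0)), threeCoord (Sum.inr (1, 0)), threeCoord (Sum.inr (2, 0))]
  have hmem : ∀ x, x ∈ dualLat UU3A23Mat ↔ (fun i => x (Sum.inl i)) ∈ dualLat UU3Mat ∧
      ∀ p, (fun q => x (Sum.inr (p, q))) ∈ dualLat A2MatQ := fun x =>
    mem_dualLat_fromBlocks.trans (and_congr_right' mem_dualLat_A2PowMatQ)
  have hint : ∀ x ∈ dualLat UU3A23Mat, ∀ i, ∃ k : ℤ, ℓ i x = k := by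
    intro x hx
    obtain ⟨hU, hA⟩ := (hmem x).1 hx
    obtain ⟨a, b, p, q, -, -, hp, hq⟩ := mem_dualLat_UU3Mat.1 hU
    choose t r ht hr using fun p => mem_dualLat_A2MatQ.1 (hA p)
    simp only [Fin.forall_fin_succ, IsEmpty.forall_iff, and_true]
    simp [ℓ, threeCoord_apply]
    refine ⟨⟨p + q, ?_⟩, ⟨p - q, ?_⟩, ⟨t 0, ?_⟩, ⟨t 1, ?_⟩, ⟨t 2, ?_⟩⟩ <;>
      simp only [hp, hq, ht] <;> push_cast <;> ring
  obtain ⟨e, he⟩ := exists_discGroup_addEquiv (n := 3) UU3A23Mat ℓ hint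
    (by
      intro x hx
      obtain ⟨hU, hA⟩ := (hmem x).1 hx
      obtain ⟨a, b, p, q, ha, hb, hp, hq⟩ := mem_dualLat_UU3Mat.1 hU
      choose t r ht hr using fun p => mem_dualLat_A2MatQ.1 (hA p)
      rw [mem_intLat]
      constructor
      · intro h
        choose n hn using h
        simp only [Fin.forall_fin_succ, IsEmpty.forall_iff, and_true]
        refine ⟨⟨n (Sum.inl 2) + n (Sum.inl 3), ?_⟩, ⟨n (Sum.inl 2) - n (Sum.inl 3), ?_⟩,
          ⟨n (Sum.inr (0, 0)), ?_⟩, ⟨n (Sum.inr (1, 0)), ?_⟩, ⟨n (Sum.inr (2, 0)), ?_⟩⟩ <;>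
          simp [ℓ, threeCoord_apply, hn] <;> ring
      · intro h
        choose k hk using h
        have hu : 3 * x (Sum.inl 2) + 3 * x (Sum.inl 3) = 3 * k 0 := hk 0
        have hv : 3 * x (Sum.inl 2) - 3 * x (Sum.inl 3) = 3 * k 1 := hk 1
        have hA₀ : ∀ p, x (Sum.inr (p, 0)) = k p.succ.succ := by
          intro p
          have : 3 * x (Sum.inr (p, 0)) = 3 * k p.succ.succ := by
            fin_cases p
            exacts [hk 2, hk 3, hk 4]
          linarith
        rintro (i | ⟨p, i⟩)
        · fin_cases i
          · exact ⟨a, ha⟩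
          · exact ⟨b, hb⟩
          · exact ⟨p - k 0 - k 1, by push_cast; linarith⟩
          · exact ⟨p - k 0 - 2 * k 1, by push_cast; linarith⟩
        · fin_cases i
          · exact ⟨_, hA₀ p⟩
          · exact ⟨2 * k p.succ.succ + r p, by
              push_cast; linarith [hA₀ p, ht p, hr p]⟩)
    (by
      intro c
      refine ⟨Sum.elim ![0, 0, -(c 0 + c 1) / 3, (c 1 - c 0) / 3]
        fun p => ![(c p.1.succ.succ : ℚ) / 3, 2 * (c p.1.succ.succ : ℚ) / 3] p.2,
        (hmem _).2 ⟨?_, fun p => ?_⟩, ?_⟩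
      · exact mem_dualLat_UU3Mat.2 ⟨0, 0, -(c 0 + c 1), c 1 - c 0, by simp⟩
      · exact mem_dualLat_A2MatQ.2 ⟨c p.succ.succ, 0, by simp⟩
      · simp only [Fin.forall_fin_succ, IsEmpty.forall_iff, and_true]
        refine ⟨⟨-c 0, ?_⟩, ⟨-c 1, ?_⟩, ⟨0, ?_⟩, ⟨0, ?_⟩, ⟨0, ?_⟩⟩ <;>
          simp [ℓ, threeCoord_apply] <;> ring)
  refine ⟨e, fun x => ?_⟩
  choose c hc using hint x.1 x.2
  obtain ⟨hU, hA⟩ := (hmem x).1 x.2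
  obtain ⟨m, hm⟩ := Bq_UU3Mat_self hU (hc 0) (hc 1)
  obtain ⟨m₀, hm₀⟩ := Bq_A2MatQ_self (hA 0) (hc 2)
  obtain ⟨m₁, hm₁⟩ := Bq_A2MatQ_self (hA 1) (hc 3)
  obtain ⟨m₂, hm₂⟩ := Bq_A2MatQ_self (hA 2) (hc 4)
  refine ⟨c, m + m₀ + m₁ + m₂, he x c hc, ?_⟩
  refine (Bq_fromBlocks UU3Mat (A2PowMatQ 3) x.1 x.1).trans ?_
  rw [Bq_A2PowMatQ, Fin.sum_univ_three, hm, hm₀, hm₁, hm₂, modelForm]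
  push_cast
  ring

theorem exists_discGroup_E6A24Mat_addEquiv :
    ∃ e : discGroup E6A24Mat ≃+ (Fin 5 → ZMod 3), ∀ x : dualLat E6A24Mat,
      ∃ (c : Fin 5 → ℤ) (m : ℤ), (∀ i, e (discMk E6A24Mat x) i = c i) ∧
        Bq E6A24Mat x.1 x.1 = modelForm c + 2 * m := by
  let ℓ : Fin 5 → (Fin 6 ⊕ Fin 4 × Fin 2 → ℚ) →+ ℚ :=
    Fin.cons (threeCoord (Sum.inl 1)) fun p => threeCoord (Sum.inr (p, 0))
  have hmem : ∀ x, x ∈ dualLat E6A24Mat ↔ (fun i => x (Sum.inl i)) ∈ dualLat (EMatQ 6) ∧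
      ∀ p, (fun q => x (Sum.inr (p, q))) ∈ dualLat A2MatQ := fun x =>
    mem_dualLat_fromBlocks.trans (and_congr_right' mem_dualLat_A2PowMatQ)
  have hint : ∀ x ∈ dualLat E6A24Mat, ∀ i, ∃ k : ℤ, ℓ i x = k := by
    intro x hx
    obtain ⟨hE, hA⟩ := (hmem x).1 hx
    obtain ⟨s, a, b, c, d, e, h₀, h₁, h₂, h₃, h₄, h₅⟩ := mem_dualLat_EMatQ_six.1 hE
    choose t r ht hr using fun p => mem_dualLat_A2MatQ.1 (hA p)
    refine Fin.cases ⟨s, ?_⟩ fun p => ⟨t p, ?_⟩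
    · simp only [ℓ, Fin.cons_zero, threeCoord_apply, h₁]
      ring
    · simp only [ℓ, Fin.cons_succ, threeCoord_apply, ht]
      ring
  obtain ⟨e, he⟩ := exists_discGroup_addEquiv (n := 3) E6A24Mat ℓ hint
    (by
      intro x hx
      obtain ⟨hE, hA⟩ := (hmem x).1 hx
      obtain ⟨s, a, b, c, d, e, h₀, h₁, h₂, h₃, h₄, h₅⟩ := mem_dualLat_EMatQ_six.1 hE
      choose t r ht hr using fun p => mem_dualLat_A2MatQ.1 (hA p)
      rw [mem_intLat]
      constructor
      · intro h i
        choose n hn using h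
        refine Fin.cases ⟨n (Sum.inl 1), ?_⟩ (fun p => ⟨n (Sum.inr (p, 0)), ?_⟩) i <;>
          simp [ℓ, threeCoord_apply, hn]
      · intro h
        choose k hk using h
        have hs : (s : ℚ) = 3 * k 0 := by
          have : 3 * x (Sum.inl 1) = 3 * k 0 := hk 0
          linarith
        have hA₀ : ∀ p, x (Sum.inr (p, 0)) = k p.succ := by
          intro p
          have : 3 * x (Sum.inr (p, 0)) = 3 * k p.succ := hk p.succ
          linarith
        rintro (i | ⟨p, i⟩)
        · fin_cases i
          · exact ⟨a, h₀⟩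
          · exact ⟨k 0, h₁.trans (by rw [hs]; ring)⟩
          · exact ⟨2 * k 0 + b, h₂.trans (by rw [hs]; push_cast; ring)⟩
          · exact ⟨c, h₃⟩
          · exact ⟨k 0 + d, h₄.trans (by rw [hs]; push_cast; ring)⟩
          · exact ⟨2 * k 0 + e, h₅.trans (by rw [hs]; push_cast; ring)⟩
        · fin_cases i
          · exact ⟨_, hA₀ p⟩
          · exact ⟨2 * k p.succ + r p, by
              push_cast; linarith [hA₀ p, ht p, hr p]⟩)
    (by
      intro c
      refine ⟨Sum.elim ![0, c 0 / 3, 2 * c 0 / 3, 0, c 0 / 3, 2 * c 0 / 3]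
        fun p => ![(c p.1.succ : ℚ) / 3, 2 * (c p.1.succ : ℚ) / 3] p.2, (hmem _).2 ⟨?_, fun p => ?_⟩, ?_⟩
      · exact mem_dualLat_EMatQ_six.2 ⟨c 0, 0, 0, 0, 0, 0, by simp⟩
      · exact mem_dualLat_A2MatQ.2 ⟨c p.succ, 0, by simp⟩
      · refine Fin.cases ⟨0, ?_⟩ (fun p => ⟨0, ?_⟩) <;> simp [ℓ, threeCoord_apply] <;> ring)
  refine ⟨e, fun x => ?_⟩
  choose c hc using hint x.1 x.2
  obtain ⟨hE, hA⟩ := (hmem x).1 x.2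
  obtain ⟨m, hm⟩ := Bq_EMatQ_six_self hE (hc 0)
  choose k hk using fun p => Bq_A2MatQ_self (hA p) (hc (Fin.succ p))
  refine ⟨c, m + ∑ p, k p, he x c hc, ?_⟩
  refine (Bq_fromBlocks (EMatQ 6) (A2PowMatQ 4) x.1 x.1).trans ?_
  rw [Bq_A2PowMatQ, hm]
  simp only [hk, Fin.sum_univ_four, modelForm]
  push_cast
  simp
  ring

/-- The even lattices `U ⊕ U(3) ⊕ A₂^{⊕3}` and `E₆ ⊕ A₂^{⊕4}` have
isomorphic discriminant lattices: their discriminant groups are both isomorphic to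
`(ℤ/3ℤ)⁵` and there is a group isomorphism between them commuting with the discriminant
forms (for representatives `x, y` of corresponding classes, `⟨y,y⟩ ≡ ⟨x,x⟩ mod 2ℤ`). -/
theorem statement9 :
    Nonempty (discGroup UU3A23Mat ≃+ (Fin 5 → ZMod 3)) ∧
    Nonempty (discGroup E6A24Mat ≃+ (Fin 5 → ZMod 3)) ∧
    ∃ f : discGroup UU3A23Mat ≃+ discGroup E6A24Mat,
      ∀ (x : ↥(dualLat UU3A23Mat)) (y : ↥(dualLat E6A24Mat)),
        f (discMk UU3A23Mat x) = discMk E6A24Mat y →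
        ∃ m : ℤ, Bq E6A24Mat y.1 y.1 - Bq UU3A23Mat x.1 x.1 = 2 * m := by
  obtain ⟨e₁, h₁⟩ := exists_discGroup_UU3A23Mat_addEquiv
  obtain ⟨e₂, h₂⟩ := exists_discGroup_E6A24Mat_addEquiv
  refine ⟨⟨e₁⟩, ⟨e₂⟩, e₁.trans e₂.symm, fun x y hxy => ?_⟩
  obtain ⟨c, m, hc, hm⟩ := h₁ x
  obtain ⟨d, n, hd, hn⟩ := h₂ y
  rw [AddEquiv.trans_apply, AddEquiv.symm_apply_eq] at hxy
  obtain ⟨k, hk⟩ := modelForm_congr (c := c) (d := d) fun i => by rw [← hc, ← hd, hxy]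
  refine ⟨k + n - m, ?_⟩
  rw [hm, hn]
  push_cast
  linarith

end Paper
end
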